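/- Exponential concentration underlying the SLLN for the triangle density (Theorem 3.1): Assume α > −2 and that g_{α,h} attains its maximum over [0,1] at a unique point u₀* ∈ (0,1). Then for every ε > 0 there exist τ > 0 and N ∈ ℕ such that for all n ≥ N, ℙ_{n;α,h}( { x ∈ 𝒜_n : |6·T_n(x)/n³ − (u₀*)³| ≥ ε } ) ≤ exp(−τ·n²). -/

import Mathlib

open scoped Classical

/-- Number of triangles in the graph `G` on `n` vertices. -/
noncomputable def triCount {n : ℕ} (G : SimpleGraph (Fin n)) : ℕ :=
  Nat.card {s : Finset (Fin n) // G.IsNClique 3 s}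

/-- Number of edges of `G`. -/
noncomputable def edgeCount {n : ℕ} (G : SimpleGraph (Fin n)) : ℕ :=
  Nat.card G.edgeSet

/-- Gibbs weight `exp((α/n)·T_n(G) + h·E_n(G))` of the edge-triangle model. -/
noncomputable def gibbsWeight (α h : ℝ) {n : ℕ} (G : SimpleGraph (Fin n)) : ℝ :=
  Real.exp (α / n * triCount G + h * edgeCount G)

/-- The edge-triangle Gibbs probability of a set `A` of graphs on `n` vertices. -/
noncomputable def gibbsProb (α h : ℝ) (n : ℕ) (A : Set (SimpleGraph (Fin n))) : ℝ :=
  (∑ G : SimpleGraph (Fin n), if G ∈ A then gibbsWeight α h G else 0) /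
  (∑ G : SimpleGraph (Fin n), gibbsWeight α h G)

/-- The energy function `g_{α,h}(u) = (α/6)u³ + (h/2)u − I(u)/2`
(note `Real.log 0 = 0`, so the boundary convention `I(0)=I(1)=0` is automatic). -/
noncomputable def gFun (α h u : ℝ) : ℝ :=
  α / 6 * u ^ 3 + h / 2 * u - (u * Real.log u + (1 - u) * Real.log (1 - u)) / 2


section FiniteConditionalExpectation

variable {Ω β : Type*} [Fintype Ω]

/-- Conditional expectation of `f` given `F` under the weight `w` on a finite type. -/
noncomputable def finCondExp (w : Ω → ℝ) (F : Ω → β) (f : Ω → ℝ) (a : Ω) : ℝ :=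
  (∑ b with F b = F a, w b * f b) / ∑ b with F b = F a, w b

theorem finCondExp_congr (w : Ω → ℝ) (F : Ω → β) (f : Ω → ℝ) {a b : Ω} (h : F a = F b) :
    finCondExp w F f a = finCondExp w F f b := by
  simp only [finCondExp, h]

theorem sum_fiber_pos {w : Ω → ℝ} (hw : ∀ a, 0 < w a) (F : Ω → β) (a : Ω) :
    0 < ∑ b with F b = F a, w b :=
  Finset.sum_pos (fun b _ => hw b) ⟨a, by simp⟩

theorem finCondExp_nonneg {w : Ω → ℝ} (hw : ∀ a, 0 < w a) (F : Ω → β) {f : Ω → ℝ}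
    (hf : ∀ a, 0 ≤ f a) (a : Ω) : 0 ≤ finCondExp w F f a :=
  div_nonneg (Finset.sum_nonneg fun b _ => mul_nonneg (hw b).le (hf b)) (sum_fiber_pos hw F a).le

theorem finCondExp_pos {w : Ω → ℝ} (hw : ∀ a, 0 < w a) (F : Ω → β) {f : Ω → ℝ}
    (hf : ∀ a, 0 ≤ f a) {a : Ω} (ha : 0 < f a) : 0 < finCondExp w F f a :=
  div_pos (Finset.sum_pos' (fun b _ => mul_nonneg (hw b).le (hf b))
    ⟨a, by simp, mul_pos (hw a) ha⟩) (sum_fiber_pos hw F a)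

theorem finCondExp_one_sub {w : Ω → ℝ} (hw : ∀ a, 0 < w a) (F : Ω → β) (f : Ω → ℝ) (a : Ω) :
    finCondExp w F (fun b => 1 - f b) a = 1 - finCondExp w F f a := by
  have h := (sum_fiber_pos hw F a).ne'
  simp only [finCondExp, mul_sub, mul_one, Finset.sum_sub_distrib, sub_div, div_self h]

theorem finCondExp_le_one {w : Ω → ℝ} (hw : ∀ a, 0 < w a) (F : Ω → β) {f : Ω → ℝ}
    (hf : ∀ a, f a ≤ 1) (a : Ω) : finCondExp w F f a ≤ 1 := by
  have h := finCondExp_nonneg hw F (f := fun b => 1 - f b) (fun b => sub_nonneg.2 (hf b)) a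
  rw [finCondExp_one_sub hw] at h
  linarith

/-- The pull-out property. -/
theorem sum_mul_finCondExp_mul {w : Ω → ℝ} (hw : ∀ a, 0 < w a) (F : Ω → β) (f : Ω → ℝ)
    {g : Ω → ℝ} (hg : ∀ a b, F a = F b → g a = g b) :
    ∑ a, w a * (finCondExp w F f a * g a) = ∑ a, w a * (f a * g a) := by
  have key : ∀ a, w a * (finCondExp w F f a * g a) =
      ∑ b, if F b = F a then w a * (w b * f b * g b) / ∑ c with F c = F b, w c else 0 := by
    intro a
    rw [finCondExp, Finset.sum_filter, ← Finset.sum_filter, ← Finset.sum_filter, div_mul_eq_mul_div,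
      Finset.sum_mul, mul_div_assoc', Finset.mul_sum, Finset.sum_div]
    refine Finset.sum_congr rfl fun b hb => ?_
    have hb := (Finset.mem_filter.1 hb).2
    simp only [hb, hg b a hb]
  rw [Finset.sum_congr rfl fun a _ => key a, Finset.sum_comm]
  refine Finset.sum_congr rfl fun b _ => ?_
  have h := (sum_fiber_pos hw F b).ne'
  have : ∀ a, (F b = F a) = (F a = F b) := fun a => propext eq_comm
  simp only [this]
  rw [← Finset.sum_filter, ← Finset.sum_div, ← Finset.sum_mul]
  field_simp

theorem sum_mul_finCondExp_sub_sq {γ : Type*} {w : Ω → ℝ} (hw : ∀ a, 0 < w a) {F : Ω → β}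
    {F' : Ω → γ} (hF : ∀ a b, F' a = F' b → F a = F b) (f : Ω → ℝ) :
    ∑ a, w a * (finCondExp w F' f a - finCondExp w F f a) ^ 2 =
      ∑ a, w a * finCondExp w F' f a ^ 2 - ∑ a, w a * finCondExp w F f a ^ 2 := by
  have h1 := sum_mul_finCondExp_mul hw F' f (g := finCondExp w F f)
    fun a b h => finCondExp_congr w F f (hF a b h)
  have h2 := sum_mul_finCondExp_mul hw F f (g := finCondExp w F f)
    fun a b h => finCondExp_congr w F f h
  have h3 : ∀ a, w a * (finCondExp w F' f a - finCondExp w F f a) ^ 2 =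
      w a * finCondExp w F' f a ^ 2 - 2 * (w a * (finCondExp w F' f a * finCondExp w F f a))
        + w a * finCondExp w F f a ^ 2 := fun a => by ring
  have h4 : ∀ a, w a * (finCondExp w F f a * finCondExp w F f a) = w a * finCondExp w F f a ^ 2 :=
    fun a => by ring
  simp only [h4] at h2
  simp only [h3, Finset.sum_add_distrib, Finset.sum_sub_distrib, ← Finset.mul_sum, h1]
  linarith

/-- Gibbs' inequality for a positive weight against a positive subprobability. -/
theorem sum_mul_log_le_sum_mul_log {w q : Ω → ℝ} (hw : ∀ a, 0 < w a) (hw1 : ∑ a, w a = 1)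
    (hq : ∀ a, 0 < q a) (hq1 : ∑ a, q a ≤ 1) :
    ∑ a, w a * Real.log (q a) ≤ ∑ a, w a * Real.log (w a) := by
  have h : ∀ a, w a * Real.log (q a) - w a * Real.log (w a) ≤ q a - w a := by
    intro a
    have h1 := Real.log_le_sub_one_of_pos (div_pos (hq a) (hw a))
    rw [Real.log_div (hq a).ne' (hw a).ne'] at h1
    have h2 := mul_le_mul_of_nonneg_left h1 (hw a).le
    have h3 : w a * (q a / w a - 1) = q a - w a := by
      have := (hw a).ne'
      field_simp
    linarith
  have := Finset.sum_le_sum fun a (_ : a ∈ Finset.univ) => h a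
  simp only [Finset.sum_sub_distrib] at this
  linarith

end FiniteConditionalExpectation

section EdgeIndicators

variable {n : ℕ}

/-- The non-loop unordered pairs of vertices. -/
noncomputable def vertexPairs (n : ℕ) : Finset (Sym2 (Fin n)) :=
  Finset.univ.filter fun e => ¬ e.IsDiag

/-- The indicator of the presence of the edge `e` in `G`. -/
noncomputable def edgeInd (e : Sym2 (Fin n)) (G : SimpleGraph (Fin n)) : ℝ :=
  if e ∈ G.edgeSet then 1 else 0

theorem edgeInd_nonneg (e : Sym2 (Fin n)) (G : SimpleGraph (Fin n)) : 0 ≤ edgeInd e G := by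
  unfold edgeInd; split_ifs <;> norm_num

theorem edgeInd_le_one (e : Sym2 (Fin n)) (G : SimpleGraph (Fin n)) : edgeInd e G ≤ 1 := by
  unfold edgeInd; split_ifs <;> norm_num

theorem edgeInd_diag (i : Fin n) (G : SimpleGraph (Fin n)) : edgeInd s(i, i) G = 0 := by
  simp [edgeInd]

theorem sum_sum_sym2 (f : Sym2 (Fin n) → ℝ) :
    ∑ i, ∑ j, f s(i, j) = 2 * ∑ e ∈ vertexPairs n, f e + ∑ i, f s(i, i) := by
  have h1 : ∑ e ∈ vertexPairs n, f e =
      ∑ p : Fin n × Fin n, if p.1 < p.2 then f s(p.1, p.2) else 0 := by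
    have := Finset.sum_sym2_filter_not_isDiag (Finset.univ : Finset (Fin n)) f
    rw [Finset.sym2_univ] at this
    rw [vertexPairs, this, ← Finset.sum_filter]
    refine Finset.sum_congr ?_ fun _ _ => rfl
    ext p
    simp only [Finset.mem_filter, Finset.mem_offDiag, Finset.mem_univ, true_and,
      and_iff_right_iff_imp]
    exact fun h => h.ne
  rw [Fintype.sum_prod_type] at h1
  have h2 : ∑ e ∈ vertexPairs n, f e = ∑ i, ∑ j, if j < i then f s(i, j) else 0 := by
    rw [h1, Finset.sum_comm]
    simp only [Sym2.eq_swap]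
  have h3 : ∀ i, f s(i, i) = ∑ j, if i = j then f s(i, j) else 0 := by
    intro i
    simp
  rw [two_mul]
  nth_rewrite 1 [h1]
  rw [h2, Finset.sum_congr rfl fun i _ => h3 i, ← Finset.sum_add_distrib, ← Finset.sum_add_distrib]
  refine Finset.sum_congr rfl fun i _ => ?_
  rw [← Finset.sum_add_distrib, ← Finset.sum_add_distrib]
  refine Finset.sum_congr rfl fun j _ => ?_
  rcases lt_trichotomy i j with h | h | h
  · simp [h, h.ne, h.not_gt]
  · simp [h]
  · simp [h, h.ne', h.not_gt]

theorem edgeSet_subset_vertexPairs (G : SimpleGraph (Fin n)) {e : Sym2 (Fin n)}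
    (he : e ∈ G.edgeSet) : e ∈ vertexPairs n := by
  simpa [vertexPairs] using G.not_isDiag_of_mem_edgeSet he

theorem edgeCount_eq_sum (G : SimpleGraph (Fin n)) :
    (edgeCount G : ℝ) = ∑ e ∈ vertexPairs n, edgeInd e G := by
  have h : (vertexPairs n).filter (fun e => e ∈ G.edgeSet) = G.edgeFinset := by
    ext e
    simp only [Finset.mem_filter, SimpleGraph.mem_edgeFinset, and_iff_right_iff_imp]
    exact fun he => edgeSet_subset_vertexPairs G he
  simp only [edgeInd]
  rw [Finset.sum_boole, h, edgeCount, Nat.card_eq_fintype_card, SimpleGraph.edgeFinset_card]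

theorem six_mul_triCount (G : SimpleGraph (Fin n)) :
    6 * (triCount G : ℝ) =
      ∑ i, ∑ j, ∑ k, edgeInd s(i, j) G * edgeInd s(j, k) G * edgeInd s(i, k) G := by
  let A : Finset (Fin n × Fin n × Fin n) :=
    Finset.univ.filter fun p => G.Adj p.1 p.2.1 ∧ G.Adj p.2.1 p.2.2 ∧ G.Adj p.1 p.2.2
  have hA : ∑ i, ∑ j, ∑ k, edgeInd s(i, j) G * edgeInd s(j, k) G * edgeInd s(i, k) G =
      (A.card : ℝ) := by
    rw [← Finset.sum_boole, Fintype.sum_prod_type]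
    refine Finset.sum_congr rfl fun i _ => ?_
    rw [Fintype.sum_prod_type]
    refine Finset.sum_congr rfl fun j _ => Finset.sum_congr rfl fun k _ => ?_
    simp only [edgeInd, SimpleGraph.mem_edgeSet]
    split_ifs <;> simp_all
  have hT : triCount G = (G.cliqueFinset 3).card := by
    rw [triCount, Nat.card_eq_fintype_card, Fintype.card_subtype]
    congr 1
  rw [hA, hT]
  have hmaps : ∀ p ∈ A, ({p.1, p.2.1, p.2.2} : Finset (Fin n)) ∈ G.cliqueFinset 3 := by
    intro p hp
    obtain ⟨h1, h2, h3⟩ := (Finset.mem_filter.1 hp).2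
    rw [SimpleGraph.mem_cliqueFinset_iff, SimpleGraph.is3Clique_triple_iff]
    exact ⟨h1, h3, h2⟩
  have hcard := Finset.card_eq_sum_card_fiberwise hmaps
  have hfib : ∀ s ∈ G.cliqueFinset 3,
      (A.filter fun p => ({p.1, p.2.1, p.2.2} : Finset (Fin n)) = s).card = 6 := by
    intro s hs
    obtain ⟨a, b, c, hab, hac, hbc, rfl⟩ :=
      SimpleGraph.is3Clique_iff.1 ((SimpleGraph.mem_cliqueFinset_iff).1 hs)
    have h1 := hab.ne
    have h2 := hac.ne
    have h3 := hbc.ne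
    have : (A.filter fun p => ({p.1, p.2.1, p.2.2} : Finset (Fin n)) = {a, b, c}) =
        {(a, b, c), (a, c, b), (b, a, c), (b, c, a), (c, a, b), (c, b, a)} := by
      ext ⟨x, y, z⟩
      simp only [A, Finset.mem_filter, Finset.mem_univ, true_and, Finset.mem_insert,
        Finset.mem_singleton, Prod.mk.injEq]
      constructor
      · rintro ⟨⟨hxy, hyz, hxz⟩, h⟩
        have hx : x ∈ ({a, b, c} : Finset (Fin n)) := h ▸ by simp
        have hy : y ∈ ({a, b, c} : Finset (Fin n)) := h ▸ by simp
        have hz : z ∈ ({a, b, c} : Finset (Fin n)) := h ▸ by simp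
        simp only [Finset.mem_insert, Finset.mem_singleton] at hx hy hz
        have := hxy.ne
        have := hyz.ne
        have := hxz.ne
        grind
      · have := hab.symm
        have := hac.symm
        have := hbc.symm
        rintro (⟨rfl, rfl, rfl⟩ | ⟨rfl, rfl, rfl⟩ | ⟨rfl, rfl, rfl⟩ | ⟨rfl, rfl, rfl⟩ |
          ⟨rfl, rfl, rfl⟩ | ⟨rfl, rfl, rfl⟩) <;>
        refine ⟨⟨by assumption, by assumption, by assumption⟩, ?_⟩ <;> ext t <;> simp <;> tauto
    rw [this]
    rw [Finset.card_insert_of_notMem, Finset.card_insert_of_notMem, Finset.card_insert_of_notMem,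
      Finset.card_insert_of_notMem, Finset.card_insert_of_notMem, Finset.card_singleton] <;>
    simp [h1, h2, h3, h1.symm, h2.symm, h3.symm]
  rw [Finset.sum_congr rfl hfib, Finset.sum_const, smul_eq_mul] at hcard
  rw [hcard]
  push_cast
  ring

/-- Expanding a product over vertex pairs as a sum over graphs. -/
theorem sum_graph_prod (a b : Sym2 (Fin n) → ℝ) :
    ∑ G : SimpleGraph (Fin n), ∏ e ∈ vertexPairs n, (if e ∈ G.edgeSet then a e else b e) =
      ∏ e ∈ vertexPairs n, (a e + b e) := by
  rw [Finset.prod_add]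
  refine Finset.sum_bij' (fun G _ => G.edgeFinset)
    (fun t _ => SimpleGraph.fromEdgeSet (t : Set (Sym2 (Fin n)))) ?_ ?_ ?_ ?_ ?_
  · intro G _
    rw [Finset.mem_powerset]
    intro e he
    exact edgeSet_subset_vertexPairs G (SimpleGraph.mem_edgeFinset.1 he)
  · simp
  · intro G _
    simp
  · intro t ht
    rw [Finset.mem_powerset] at ht
    ext e
    simp only [SimpleGraph.mem_edgeFinset, SimpleGraph.edgeSet_fromEdgeSet]
    constructor
    · exact fun h => h.1
    · intro h
      refine ⟨h, ?_⟩
      simpa [vertexPairs] using ht h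
  · intro G _
    rw [Finset.prod_ite]
    congr 1
    · refine Finset.prod_congr ?_ fun _ _ => rfl
      ext e
      simp only [Finset.mem_filter, SimpleGraph.mem_edgeFinset, and_iff_right_iff_imp]
      exact fun he => edgeSet_subset_vertexPairs G he
    · refine Finset.prod_congr ?_ fun _ _ => rfl
      ext e
      simp

end EdgeIndicators

section Reveal

variable {n : ℕ}

/-- The edges of `G` that meet the vertex set `S`. -/
noncomputable def revealed (S : Finset (Fin n)) (G : SimpleGraph (Fin n)) :
    Finset (Sym2 (Fin n)) :=
  G.edgeFinset.filter fun e => ∃ v ∈ S, v ∈ e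

theorem card_image_revealed (S : Finset (Fin n)) :
    (Finset.univ.image (revealed S)).card ≤ 2 ^ (S.card * n) := by
  let I : Finset (Sym2 (Fin n)) := (S ×ˢ Finset.univ).image fun p => s(p.1, p.2)
  have h1 : Finset.univ.image (revealed S) ⊆ I.powerset := by
    intro t ht
    obtain ⟨G, -, rfl⟩ := Finset.mem_image.1 ht
    rw [Finset.mem_powerset]
    intro e he
    obtain ⟨-, v, hv, hve⟩ := Finset.mem_filter.1 he
    obtain ⟨u, rfl⟩ := Sym2.mem_iff_exists.1 hve
    exact Finset.mem_image.2 ⟨(v, u), by simp [hv], rfl⟩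
  have h2 : I.card ≤ S.card * n := by
    refine Finset.card_image_le.trans ?_
    simp [Finset.card_product]
  calc _ ≤ I.powerset.card := Finset.card_le_card h1
    _ = 2 ^ I.card := Finset.card_powerset I
    _ ≤ _ := Nat.pow_le_pow_right (by norm_num) h2

theorem revealed_mono {S S' : Finset (Fin n)} (h : S ⊆ S') {G G' : SimpleGraph (Fin n)}
    (hG : revealed S' G = revealed S' G') : revealed S G = revealed S G' := by
  have key : ∀ H : SimpleGraph (Fin n),
      revealed S H = (revealed S' H).filter fun e => ∃ v ∈ S, v ∈ e := by
    intro H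
    ext e
    simp only [revealed, Finset.mem_filter]
    constructor
    · rintro ⟨h1, v, hv, hve⟩
      exact ⟨⟨h1, v, h hv, hve⟩, v, hv, hve⟩
    · rintro ⟨⟨h1, -⟩, h2⟩
      exact ⟨h1, h2⟩
  rw [key, key, hG]

theorem edgeInd_eq_of_revealed_eq {S : Finset (Fin n)} {v : Fin n} (hv : v ∈ S)
    {e : Sym2 (Fin n)} (he : v ∈ e) (G G' : SimpleGraph (Fin n))
    (hG : revealed S G = revealed S G') : edgeInd e G = edgeInd e G' := by
  have h : e ∈ G.edgeSet ↔ e ∈ G'.edgeSet := by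
    have h1 := Finset.ext_iff.1 hG e
    have h2 : ∃ v ∈ S, v ∈ e := ⟨v, hv, he⟩
    simpa [revealed, h2] using h1
  simp only [edgeInd, h]

/-- The conditional edge probability given the edges that meet `S`. -/
noncomputable def condEdge (w : SimpleGraph (Fin n) → ℝ) (S : Finset (Fin n))
    (e : Sym2 (Fin n)) (G : SimpleGraph (Fin n)) : ℝ :=
  finCondExp w (revealed S) (edgeInd e) G

variable {w : SimpleGraph (Fin n) → ℝ}

theorem condEdge_mem_Icc (hw : ∀ G, 0 < w G) (S : Finset (Fin n)) (e : Sym2 (Fin n))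
    (G : SimpleGraph (Fin n)) : condEdge w S e G ∈ Set.Icc (0 : ℝ) 1 :=
  ⟨finCondExp_nonneg hw _ (edgeInd_nonneg e) G, finCondExp_le_one hw _ (edgeInd_le_one e) G⟩

/-- Entropy subadditivity, conditionally on the edges that meet `S`. -/
theorem entropy_le_sum_binEntropy (hw : ∀ G, 0 < w G) (hw1 : ∑ G, w G = 1)
    (S : Finset (Fin n)) :
    -∑ G, w G * Real.log (w G) ≤ S.card * n * Real.log 2 +
      ∑ G, w G * ∑ e ∈ vertexPairs n, Real.binEntropy (condEdge w S e G) := by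
  let r : SimpleGraph (Fin n) → Sym2 (Fin n) → ℝ := fun G e =>
    if e ∈ G.edgeSet then condEdge w S e G else 1 - condEdge w S e G
  have hr : ∀ G e, 0 < r G e := by
    intro G e
    by_cases h : e ∈ G.edgeSet
    · simp only [r, h, if_true]
      exact finCondExp_pos hw _ (edgeInd_nonneg e) (by simp [edgeInd, h])
    · simp only [r, h, if_false]
      rw [condEdge, ← finCondExp_one_sub hw]
      exact finCondExp_pos hw _ (fun a => sub_nonneg.2 (edgeInd_le_one e a)) (by simp [edgeInd, h])
  let q : SimpleGraph (Fin n) → ℝ := fun G =>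
    ((2 : ℝ) ^ (S.card * n))⁻¹ * ∏ e ∈ vertexPairs n, r G e
  have hq : ∀ G, 0 < q G := fun G =>
    mul_pos (by positivity) (Finset.prod_pos fun e _ => hr G e)
  have hq1 : ∑ G, q G ≤ 1 := by
    have h1 : ∑ G, ∏ e ∈ vertexPairs n, r G e ≤
        ((Finset.univ.image (revealed S)).card : ℝ) := by
      rw [← Finset.sum_fiberwise_of_maps_to (s := Finset.univ)
        (t := Finset.univ.image (revealed S)) (g := revealed S)
        (fun G _ => Finset.mem_image_of_mem _ (Finset.mem_univ G)), Finset.card_eq_sum_ones]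
      push_cast
      refine Finset.sum_le_sum fun t ht => ?_
      obtain ⟨G₀, -, rfl⟩ := Finset.mem_image.1 ht
      let r₀ : SimpleGraph (Fin n) → Sym2 (Fin n) → ℝ := fun G e =>
        if e ∈ G.edgeSet then condEdge w S e G₀ else 1 - condEdge w S e G₀
      calc _ = ∑ G with revealed S G = revealed S G₀, ∏ e ∈ vertexPairs n, r₀ G e := by
            refine Finset.sum_congr rfl fun G hG => Finset.prod_congr rfl fun e _ => ?_
            simp only [r, r₀, condEdge,
              finCondExp_congr w (revealed S) (edgeInd e) (Finset.mem_filter.1 hG).2]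
        _ ≤ ∑ G, ∏ e ∈ vertexPairs n, r₀ G e := by
            refine Finset.sum_le_sum_of_subset_of_nonneg (Finset.filter_subset _ _)
              fun G _ _ => Finset.prod_nonneg fun e _ => ?_
            have := condEdge_mem_Icc hw S e G₀
            simp only [r₀]
            split_ifs
            · exact this.1
            · linarith [this.2]
        _ = 1 := by
            simp only [r₀]
            rw [sum_graph_prod (fun e => condEdge w S e G₀) (fun e => 1 - condEdge w S e G₀)]
            simp
    have h2 : ((Finset.univ.image (revealed S)).card : ℝ) ≤ 2 ^ (S.card * n) := by
      exact_mod_cast card_image_revealed S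
    simp only [q]
    rw [← Finset.mul_sum, inv_mul_le_iff₀ (by positivity), mul_one]
    exact h1.trans h2
  have hGibbs := sum_mul_log_le_sum_mul_log hw hw1 hq hq1
  have hlog : ∀ G, Real.log (q G) =
      -(S.card * n * Real.log 2) + ∑ e ∈ vertexPairs n, Real.log (r G e) := by
    intro G
    simp only [q]
    rw [Real.log_mul (by positivity) (Finset.prod_pos fun e _ => hr G e).ne', Real.log_inv,
      Real.log_pow, Real.log_prod fun e _ => (hr G e).ne']
    push_cast
    ring
  have hterm : ∀ e, ∑ G, w G * Real.log (r G e) =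
      -∑ G, w G * Real.binEntropy (condEdge w S e G) := by
    intro e
    have h := sum_mul_finCondExp_mul hw (revealed S) (edgeInd e)
      (g := fun G => Real.log (condEdge w S e G) - Real.log (1 - condEdge w S e G))
      (fun a b hab => by simp only [condEdge, finCondExp_congr w (revealed S) (edgeInd e) hab])
    have h1 : ∀ G, w G * Real.log (r G e) = w G * (edgeInd e G *
        (Real.log (condEdge w S e G) - Real.log (1 - condEdge w S e G))) +
        w G * Real.log (1 - condEdge w S e G) := by
      intro G
      simp only [r, edgeInd]
      split_ifs <;> ring
    rw [Finset.sum_congr rfl fun G _ => h1 G, Finset.sum_add_distrib, ← h,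
      ← Finset.sum_add_distrib, ← Finset.sum_neg_distrib]
    refine Finset.sum_congr rfl fun G _ => ?_
    rw [Real.binEntropy, Real.log_inv, Real.log_inv]
    simp only [condEdge]
    ring
  have hsum : ∑ G, w G * Real.log (q G) = -(S.card * n * Real.log 2) -
      ∑ G, w G * ∑ e ∈ vertexPairs n, Real.binEntropy (condEdge w S e G) := by
    simp only [hlog, mul_add, Finset.sum_add_distrib, Finset.mul_sum]
    rw [← Finset.sum_mul, hw1, Finset.sum_comm, Finset.sum_congr rfl fun e _ => hterm e,
      Finset.sum_neg_distrib, Finset.sum_comm]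
    ring
  linarith

/-- Replacing the three edge indicators of a triangle by conditional edge probabilities. -/
theorem sum_triangle_sub_le (hw : ∀ G, 0 < w G) (S : Finset (Fin n)) (i j k : Fin n) :
    |∑ G, w G * (edgeInd s(i, j) G * edgeInd s(j, k) G * edgeInd s(i, k) G) -
      ∑ G, w G * (condEdge w S s(i, j) G * condEdge w S s(j, k) G * condEdge w S s(i, k) G)| ≤
    ∑ G, w G * |condEdge w (insert k S) s(i, j) G - condEdge w S s(i, j) G| +
      ∑ G, w G * |condEdge w (insert i S) s(j, k) G - condEdge w S s(j, k) G| := by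
  have hk : k ∈ insert k S := Finset.mem_insert_self _ _
  have hi : i ∈ insert i S := Finset.mem_insert_self _ _
  have e1 := sum_mul_finCondExp_mul hw (revealed (insert k S)) (edgeInd s(i, j))
    (g := fun G => edgeInd s(j, k) G * edgeInd s(i, k) G) (fun a b h => by
      simp only [edgeInd_eq_of_revealed_eq hk (e := s(j, k)) (by simp) a b h,
        edgeInd_eq_of_revealed_eq hk (e := s(i, k)) (by simp) a b h])
  have e2 := sum_mul_finCondExp_mul hw (revealed (insert i S)) (edgeInd s(j, k))
    (g := fun G => condEdge w S s(i, j) G * edgeInd s(i, k) G) (fun a b h => by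
      simp only [edgeInd_eq_of_revealed_eq hi (e := s(i, k)) (by simp) a b h, condEdge,
        finCondExp_congr w (revealed S) (edgeInd s(i, j))
          (revealed_mono (Finset.subset_insert i S) h)])
  have e3 := sum_mul_finCondExp_mul hw (revealed S) (edgeInd s(i, k))
    (g := fun G => condEdge w S s(i, j) G * condEdge w S s(j, k) G) (fun a b h => by
      simp only [condEdge, finCondExp_congr w (revealed S) (edgeInd s(i, j)) h,
        finCondExp_congr w (revealed S) (edgeInd s(j, k)) h])
  have e4 : ∑ G, w G * (edgeInd s(i, j) G * edgeInd s(j, k) G * edgeInd s(i, k) G) -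
      ∑ G, w G * (condEdge w S s(i, j) G * condEdge w S s(j, k) G * condEdge w S s(i, k) G) =
      ∑ G, w G * ((condEdge w (insert k S) s(i, j) G - condEdge w S s(i, j) G) *
        (edgeInd s(j, k) G * edgeInd s(i, k) G)) +
      ∑ G, w G * ((condEdge w (insert i S) s(j, k) G - condEdge w S s(j, k) G) *
        (condEdge w S s(i, j) G * edgeInd s(i, k) G)) := by
    simp only [sub_mul, mul_sub, Finset.sum_sub_distrib]
    simp only [← condEdge.eq_1] at e1 e2 e3
    rw [e1, e2]
    have r0 : ∀ G, w G * (edgeInd s(i, j) G * edgeInd s(j, k) G * edgeInd s(i, k) G) =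
      w G * (edgeInd s(i, j) G * (edgeInd s(j, k) G * edgeInd s(i, k) G)) :=
        fun G => by ring
    have r1 : ∀ G, w G * (edgeInd s(j, k) G * (condEdge w S s(i, j) G * edgeInd s(i, k) G)) =
      w G * (condEdge w S s(i, j) G * (edgeInd s(j, k) G * edgeInd s(i, k) G)) :=
        fun G => by ring
    have r2 : ∀ G, w G * (condEdge w S s(j, k) G * (condEdge w S s(i, j) G * edgeInd s(i, k) G)) =
      w G * (edgeInd s(i, k) G * (condEdge w S s(i, j) G * condEdge w S s(j, k) G)) :=
        fun G => by ring
    have r3 : ∀ G, w G * (condEdge w S s(i, j) G * condEdge w S s(j, k) G *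
        condEdge w S s(i, k) G) =
      w G * (condEdge w S s(i, k) G * (condEdge w S s(i, j) G * condEdge w S s(j, k) G)) :=
        fun G => by ring
    simp only [r0, r1, r2, r3, e3]
    ring
  rw [e4]
  refine (abs_add_le _ _).trans (add_le_add ?_ ?_) <;>
  refine (Finset.abs_sum_le_sum_abs _ _).trans (Finset.sum_le_sum fun G _ => ?_) <;>
  rw [abs_mul, abs_mul, abs_of_pos (hw G)] <;>
  refine mul_le_mul_of_nonneg_left (mul_le_of_le_one_right (abs_nonneg _) ?_) (hw G).le <;>
  rw [abs_le]
  · have := edgeInd_nonneg s(j, k) G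
    have := edgeInd_nonneg s(i, k) G
    have := edgeInd_le_one s(j, k) G
    have := edgeInd_le_one s(i, k) G
    constructor <;> nlinarith
  · obtain ⟨_, _⟩ := condEdge_mem_Icc hw S s(i, j) G
    have := edgeInd_nonneg s(i, k) G
    have := edgeInd_le_one s(i, k) G
    constructor <;> nlinarith

/-- The total second moment of the conditional edge probabilities. -/
noncomputable def condEnergy (w : SimpleGraph (Fin n) → ℝ) (S : Finset (Fin n)) : ℝ :=
  ∑ i, ∑ j, ∑ G, w G * condEdge w S s(i, j) G ^ 2

theorem condEnergy_insert_sub (hw : ∀ G, 0 < w G) (S : Finset (Fin n)) (k : Fin n) :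
    condEnergy w (insert k S) - condEnergy w S =
      ∑ i, ∑ j, ∑ G, w G * (condEdge w (insert k S) s(i, j) G - condEdge w S s(i, j) G) ^ 2 := by
  simp only [condEnergy, ← Finset.sum_sub_distrib (f := fun i => ∑ j, ∑ G, _)]
  refine Finset.sum_congr rfl fun i _ => ?_
  rw [← Finset.sum_sub_distrib]
  refine Finset.sum_congr rfl fun j _ => ?_
  exact (sum_mul_finCondExp_sub_sq hw
    (fun a b h => revealed_mono (Finset.subset_insert k S) h) _).symm

theorem condEnergy_le (hw : ∀ G, 0 < w G) (hw1 : ∑ G, w G = 1) (S : Finset (Fin n)) :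
    condEnergy w S ≤ (n : ℝ) ^ 2 := by
  have h : ∀ i j : Fin n, ∑ G, w G * condEdge w S s(i, j) G ^ 2 ≤ 1 := by
    intro i j
    rw [← hw1]
    refine Finset.sum_le_sum fun G _ => mul_le_of_le_one_right (hw G).le ?_
    obtain ⟨h0, h1⟩ := condEdge_mem_Icc hw S s(i, j) G
    exact pow_le_one₀ h0 h1
  calc condEnergy w S ≤ ∑ _i : Fin n, ∑ _j : Fin n, (1 : ℝ) :=
        Finset.sum_le_sum fun i _ => Finset.sum_le_sum fun j _ => h i j
    _ = (n : ℝ) ^ 2 := by simp [sq]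

/-- A bounded number of vertices suffices to make the average energy increment small. -/
theorem exists_small_increment (hn : 0 < n) (hw : ∀ G, 0 < w G) (hw1 : ∑ G, w G = 1)
    {δ : ℝ} {K : ℕ} (hK : 1 < K * δ) :
    ∃ S : Finset (Fin n), S.card ≤ K ∧
      ∑ k, (condEnergy w (insert k S) - condEnergy w S) ≤ δ * (n : ℝ) ^ 3 := by
  by_contra! hcon
  have hn' : (0 : ℝ) < n := by exact_mod_cast hn
  have key : ∀ m ≤ K, ∃ S : Finset (Fin n), S.card ≤ m ∧ m * δ * (n : ℝ) ^ 2 ≤ condEnergy w S := by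
    intro m
    induction m with
    | zero =>
      intro _
      refine ⟨∅, by simp, ?_⟩
      simp only [CharP.cast_eq_zero, zero_mul]
      exact Finset.sum_nonneg fun i _ => Finset.sum_nonneg fun j _ =>
        Finset.sum_nonneg fun G _ => mul_nonneg (hw G).le (sq_nonneg _)
    | succ m ih =>
      intro hm
      obtain ⟨S, hS, hE⟩ := ih (by omega)
      have h1 := hcon S (by omega)
      have h2 : ∑ _k : Fin n, δ * (n : ℝ) ^ 2 = δ * (n : ℝ) ^ 3 := by
        simp; ring
      rw [← h2] at h1
      obtain ⟨k, -, hk⟩ := Finset.exists_lt_of_sum_lt h1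
      refine ⟨insert k S, (Finset.card_insert_le _ _).trans (by omega), ?_⟩
      push_cast
      nlinarith
  obtain ⟨S, -, hS⟩ := key K le_rfl
  have h1 := condEnergy_le hw hw1 S
  have h2 : (0 : ℝ) < (n : ℝ) ^ 2 := by positivity
  nlinarith

/-- A bounded vertex set whose revealed edges decouple the edges of most triangles. -/
theorem exists_decoupling (hn : 0 < n) (hw : ∀ G, 0 < w G) (hw1 : ∑ G, w G = 1)
    {η : ℝ} (hη : 0 < η) {K : ℕ} (hK : 1 < K * η ^ 2) :
    ∃ S : Finset (Fin n), S.card ≤ K ∧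
      |∑ G, w G * (∑ i, ∑ j, ∑ k,
          edgeInd s(i, j) G * edgeInd s(j, k) G * edgeInd s(i, k) G) -
        ∑ G, w G * (∑ i, ∑ j, ∑ k,
          condEdge w S s(i, j) G * condEdge w S s(j, k) G * condEdge w S s(i, k) G)| ≤
        4 * η * (n : ℝ) ^ 3 := by
  obtain ⟨S, hS, hinc⟩ := exists_small_increment hn hw hw1 hK
  refine ⟨S, hS, ?_⟩
  let D : Fin n → Fin n → Fin n → ℝ := fun i j k =>
    ∑ G, w G * |condEdge w (insert k S) s(i, j) G - condEdge w S s(i, j) G|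
  have hD : ∑ i, ∑ j, ∑ k, D i j k ≤ 2 * η * (n : ℝ) ^ 3 := by
    have h1 : ∀ i j k, D i j k ≤ η + η⁻¹ *
        ∑ G, w G * (condEdge w (insert k S) s(i, j) G - condEdge w S s(i, j) G) ^ 2 := by
      intro i j k
      have h2 : ∀ x : ℝ, |x| ≤ η + η⁻¹ * x ^ 2 := by
        intro x
        rw [← sub_nonneg]
        have : η + η⁻¹ * x ^ 2 - |x| = η⁻¹ * ((η - |x| / 2) ^ 2 + 3 / 4 * |x| ^ 2) := by
          rw [← sq_abs x]
          field_simp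
          ring
        rw [this]
        positivity
      calc D i j k ≤ ∑ G, w G * (η + η⁻¹ *
            (condEdge w (insert k S) s(i, j) G - condEdge w S s(i, j) G) ^ 2) :=
            Finset.sum_le_sum fun G _ => mul_le_mul_of_nonneg_left (h2 _) (hw G).le
        _ = _ := by
            simp only [mul_add, Finset.sum_add_distrib, ← Finset.sum_mul, hw1, one_mul,
              Finset.mul_sum]
            congr 1
            exact Finset.sum_congr rfl fun G _ => by ring
    calc ∑ i, ∑ j, ∑ k, D i j k ≤ ∑ i, ∑ j, ∑ k, (η + η⁻¹ *
        ∑ G, w G * (condEdge w (insert k S) s(i, j) G - condEdge w S s(i, j) G) ^ 2) :=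
          Finset.sum_le_sum fun i _ => Finset.sum_le_sum fun j _ =>
            Finset.sum_le_sum fun k _ => h1 i j k
      _ = η * (n : ℝ) ^ 3 + η⁻¹ * ∑ k, (condEnergy w (insert k S) - condEnergy w S) := by
          have h3 : ∑ k, (condEnergy w (insert k S) - condEnergy w S) =
              ∑ i, ∑ j, ∑ k, ∑ G, w G *
                (condEdge w (insert k S) s(i, j) G - condEdge w S s(i, j) G) ^ 2 := by
            rw [Finset.sum_congr rfl fun k _ => condEnergy_insert_sub hw S k, Finset.sum_comm]
            exact Finset.sum_congr rfl fun i _ => Finset.sum_comm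
          rw [h3]
          simp only [Finset.sum_add_distrib, ← Finset.mul_sum]
          simp
          ring
      _ ≤ η * (n : ℝ) ^ 3 + η⁻¹ * (η ^ 2 * (n : ℝ) ^ 3) := by gcongr
      _ = _ := by field_simp; ring
  have hswap : ∀ f : Fin n → Fin n → Fin n → SimpleGraph (Fin n) → ℝ,
      ∑ G, w G * (∑ i, ∑ j, ∑ k, f i j k G) = ∑ i, ∑ j, ∑ k, ∑ G, w G * f i j k G := by
    intro f
    simp only [Finset.mul_sum]
    rw [Finset.sum_comm]
    refine Finset.sum_congr rfl fun i _ => ?_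
    rw [Finset.sum_comm]
    refine Finset.sum_congr rfl fun j _ => ?_
    rw [Finset.sum_comm]
  have hD' : ∑ i, ∑ j, ∑ k, D j k i ≤ 2 * η * (n : ℝ) ^ 3 := by
    refine le_of_eq_of_le ?_ hD
    rw [Finset.sum_comm]
    exact Finset.sum_congr rfl fun i _ => Finset.sum_comm
  rw [hswap, hswap]
  simp only [← Finset.sum_sub_distrib]
  calc _ ≤ ∑ i, ∑ j, ∑ k, (D i j k + D j k i) := by
        refine (Finset.abs_sum_le_sum_abs _ _).trans (Finset.sum_le_sum fun i _ => ?_)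
        refine (Finset.abs_sum_le_sum_abs _ _).trans (Finset.sum_le_sum fun j _ => ?_)
        refine (Finset.abs_sum_le_sum_abs _ _).trans (Finset.sum_le_sum fun k _ => ?_)
        rw [Finset.sum_sub_distrib]
        exact sum_triangle_sub_le hw S i j k
    _ ≤ 4 * η * (n : ℝ) ^ 3 := by
        simp only [Finset.sum_add_distrib]
        linarith

end Reveal

section Partition

variable {n : ℕ}

theorem gibbsWeight_pos (α h : ℝ) (G : SimpleGraph (Fin n)) : 0 < gibbsWeight α h G :=
  Real.exp_pos _

theorem sum_gibbsWeight_pos (α h : ℝ) (n : ℕ) :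
    0 < ∑ G : SimpleGraph (Fin n), gibbsWeight α h G :=
  Finset.sum_pos (fun G _ => gibbsWeight_pos α h G) ⟨⊥, Finset.mem_univ _⟩

theorem log_gibbsWeight (α h : ℝ) (G : SimpleGraph (Fin n)) :
    Real.log (gibbsWeight α h G) =
      α / (6 * n) * (∑ i, ∑ j, ∑ k, edgeInd s(i, j) G * edgeInd s(j, k) G * edgeInd s(i, k) G) +
        h * ∑ e ∈ vertexPairs n, edgeInd e G := by
  rw [gibbsWeight, Real.log_exp, ← six_mul_triCount, ← edgeCount_eq_sum]
  congr 1
  rcases eq_or_ne (n : ℝ) 0 with h0 | h0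
  · simp [h0]
  · field_simp

/-- The mean-field energy of an array of edge probabilities. -/
theorem meanField_le {α h M : ℝ} {ψ : ℝ → ℝ}
    (hψ : ∀ p ∈ Set.Icc (0 : ℝ) 1, ∀ q ∈ Set.Icc (0 : ℝ) 1, ∀ r ∈ Set.Icc (0 : ℝ) 1,
      α * (p * q * r) ≤ ψ p + ψ q + ψ r)
    (hM : ∀ p ∈ Set.Icc (0 : ℝ) 1, ψ p + h * p + Real.binEntropy p ≤ 2 * M) (hn : 0 < n)
    {p : Sym2 (Fin n) → ℝ} (hp : ∀ e, p e ∈ Set.Icc (0 : ℝ) 1) (hp0 : ∀ i, p s(i, i) = 0) :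
    α / (6 * n) * (∑ i, ∑ j, ∑ k, p s(i, j) * p s(j, k) * p s(i, k)) +
      h * ∑ e ∈ vertexPairs n, p e + ∑ e ∈ vertexPairs n, Real.binEntropy (p e) ≤
      (n : ℝ) ^ 2 * M := by
  have hn' : (0 : ℝ) < n := by exact_mod_cast hn
  have h1 : α * (∑ i, ∑ j, ∑ k, p s(i, j) * p s(j, k) * p s(i, k)) ≤
      3 * n * ∑ i, ∑ j, ψ (p s(i, j)) := by
    simp only [Finset.mul_sum (a := α)]
    calc _ ≤ ∑ i, ∑ j, ∑ k, (ψ (p s(i, j)) + ψ (p s(j, k)) + ψ (p s(i, k))) :=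
          Finset.sum_le_sum fun i _ => Finset.sum_le_sum fun j _ =>
            Finset.sum_le_sum fun k _ => hψ _ (hp _) _ (hp _) _ (hp _)
      _ = _ := by
          simp only [Finset.sum_add_distrib, Finset.sum_const, Finset.card_univ, Fintype.card_fin,
            nsmul_eq_mul, ← Finset.mul_sum]
          ring
  have h2 := sum_sum_sym2 p
  have h3 := sum_sum_sym2 fun e => Real.binEntropy (p e)
  simp only [hp0, Finset.sum_const_zero, add_zero, Real.binEntropy_zero] at h2 h3
  have h4 : ∑ i, ∑ j, (ψ (p s(i, j)) + h * p s(i, j) + Real.binEntropy (p s(i, j))) ≤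
      ∑ _i : Fin n, ∑ _j : Fin n, 2 * M :=
    Finset.sum_le_sum fun i _ => Finset.sum_le_sum fun j _ => hM _ (hp _)
  simp only [Finset.sum_add_distrib, ← Finset.mul_sum, h2, h3] at h4
  simp only [Finset.sum_const, Finset.card_univ, Fintype.card_fin, nsmul_eq_mul] at h4
  have h5 : α / (6 * n) * (∑ i, ∑ j, ∑ k, p s(i, j) * p s(j, k) * p s(i, k)) ≤
      (∑ i, ∑ j, ψ (p s(i, j))) / 2 := by
    rw [div_mul_eq_mul_div, div_le_iff₀ (by positivity)]
    linarith
  nlinarith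

theorem log_partition_le {α h M : ℝ} {ψ : ℝ → ℝ}
    (hψ : ∀ p ∈ Set.Icc (0 : ℝ) 1, ∀ q ∈ Set.Icc (0 : ℝ) 1, ∀ r ∈ Set.Icc (0 : ℝ) 1,
      α * (p * q * r) ≤ ψ p + ψ q + ψ r)
    (hM : ∀ p ∈ Set.Icc (0 : ℝ) 1, ψ p + h * p + Real.binEntropy p ≤ 2 * M)
    {η : ℝ} (hη : 0 < η) {K : ℕ} (hK : 1 < K * η ^ 2) (hn : 0 < n) :
    Real.log (∑ G : SimpleGraph (Fin n), gibbsWeight α h G) ≤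
      (n : ℝ) ^ 2 * (M + |α| * η) + K * n := by
  have hn' : (0 : ℝ) < n := by exact_mod_cast hn
  set Z := ∑ G : SimpleGraph (Fin n), gibbsWeight α h G with hZ
  have hZpos : 0 < Z := sum_gibbsWeight_pos α h n
  let w : SimpleGraph (Fin n) → ℝ := fun G => gibbsWeight α h G / Z
  have hw : ∀ G, 0 < w G := fun G => div_pos (gibbsWeight_pos α h G) hZpos
  have hw1 : ∑ G, w G = 1 := by
    simp only [w]
    rw [← Finset.sum_div, ← hZ, div_self hZpos.ne']
  obtain ⟨S, hS, hdec⟩ := exists_decoupling hn hw hw1 hη hK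
  have hent := entropy_le_sum_binEntropy hw hw1 S
  have hlog : ∀ G, w G * Real.log (w G) =
      w G * Real.log (gibbsWeight α h G) - w G * Real.log Z := by
    intro G
    simp only [w]
    rw [Real.log_div (gibbsWeight_pos α h G).ne' hZpos.ne']
    ring
  simp only [hlog, log_gibbsWeight, Finset.sum_sub_distrib, ← Finset.sum_mul, hw1, one_mul] at hent
  have hmf : ∀ G, _ := fun G => meanField_le hψ hM hn (p := fun e => condEdge w S e G)
    (fun e => condEdge_mem_Icc hw S e G) (fun i => by simp [condEdge, finCondExp, edgeInd_diag])
  have hmf' := Finset.sum_le_sum fun G (_ : G ∈ Finset.univ) =>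
    mul_le_mul_of_nonneg_left (hmf G) (hw G).le
  rw [← Finset.sum_mul, hw1, one_mul] at hmf'
  have hedge : ∑ G, w G * (h * ∑ e ∈ vertexPairs n, condEdge w S e G) =
      ∑ G, w G * (h * ∑ e ∈ vertexPairs n, edgeInd e G) := by
    have h1 : ∀ e, ∑ G, w G * (h * condEdge w S e G) = ∑ G, w G * (h * edgeInd e G) := by
      intro e
      have := sum_mul_finCondExp_mul hw (revealed S) (edgeInd e) (g := fun _ => h)
        fun _ _ _ => rfl
      simpa only [condEdge, mul_comm h] using this
    simp only [Finset.mul_sum]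
    rw [Finset.sum_comm, Finset.sum_congr rfl fun e _ => by simpa using h1 e, Finset.sum_comm]
  have hpull : ∀ (c : ℝ) (f : SimpleGraph (Fin n) → ℝ),
      ∑ G, w G * (c * f G) = c * ∑ G, w G * f G := by
    intro c f
    rw [Finset.mul_sum]
    exact Finset.sum_congr rfl fun G _ => by ring
  simp only [mul_add, Finset.sum_add_distrib, hedge] at hmf' hent
  rw [hpull (α / (6 * n))] at hmf' hent
  have htri : α / (6 * n) * (∑ G, w G * (∑ i, ∑ j, ∑ k,
          edgeInd s(i, j) G * edgeInd s(j, k) G * edgeInd s(i, k) G)) -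
        α / (6 * n) * (∑ G, w G * (∑ i, ∑ j, ∑ k,
          condEdge w S s(i, j) G * condEdge w S s(j, k) G * condEdge w S s(i, k) G)) ≤
      (n : ℝ) ^ 2 * (|α| * η) := by
    rw [← mul_sub]
    refine (le_abs_self _).trans ?_
    rw [abs_mul, abs_div, abs_of_pos (by positivity : (0 : ℝ) < 6 * n)]
    calc _ ≤ |α| / (6 * n) * (4 * η * (n : ℝ) ^ 3) := by gcongr
      _ = 2 / 3 * ((n : ℝ) ^ 2 * (|α| * η)) := by field_simp; ring
      _ ≤ _ := by
        have : 0 ≤ (n : ℝ) ^ 2 * (|α| * η) := by positivity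
        linarith
  have hSK : S.card * n * Real.log 2 ≤ K * n := by
    have h1 : (S.card : ℝ) ≤ K := by exact_mod_cast hS
    have h2 : Real.log 2 ≤ 1 := by linarith [Real.log_two_lt_d9]
    calc S.card * n * Real.log 2 ≤ S.card * n * 1 := by gcongr
      _ ≤ K * n := by rw [mul_one]; gcongr
  linarith

/-- The weight of `G` under independent edges of density `u`. -/
noncomputable def bernoulliWeight (u : ℝ) (G : SimpleGraph (Fin n)) : ℝ :=
  ∏ e ∈ vertexPairs n, if e ∈ G.edgeSet then u else 1 - u

theorem sum_bernoulliWeight_mul_prod (u : ℝ) {A : Finset (Sym2 (Fin n))}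
    (hA : A ⊆ vertexPairs n) :
    ∑ G, bernoulliWeight u G * ∏ e ∈ A, edgeInd e G = u ^ A.card := by
  have h1 : ∀ G : SimpleGraph (Fin n), bernoulliWeight u G * ∏ e ∈ A, edgeInd e G =
      ∏ e ∈ vertexPairs n, if e ∈ G.edgeSet then u else (if e ∈ A then 0 else 1 - u) := by
    intro G
    have h2 : ∏ e ∈ A, edgeInd e G = ∏ e ∈ vertexPairs n, if e ∈ A then edgeInd e G else 1 := by
      rw [← Finset.prod_filter, Finset.filter_mem_eq_inter, Finset.inter_eq_right.2 hA]
    rw [bernoulliWeight, h2, ← Finset.prod_mul_distrib]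
    refine Finset.prod_congr rfl fun e _ => ?_
    simp only [edgeInd]
    split_ifs <;> simp
  rw [Finset.sum_congr rfl fun G _ => h1 G,
    sum_graph_prod (fun _ => u) (fun e => if e ∈ A then 0 else 1 - u)]
  have h3 : ∀ e, u + (if e ∈ A then 0 else 1 - u) = if e ∈ A then u else 1 := by
    intro e
    split_ifs <;> ring
  simp only [h3]
  rw [← Finset.prod_filter, Finset.filter_mem_eq_inter, Finset.inter_eq_right.2 hA,
    Finset.prod_const]

theorem sum_bernoulliWeight (u : ℝ) : ∑ G : SimpleGraph (Fin n), bernoulliWeight u G = 1 := by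
  simpa using sum_bernoulliWeight_mul_prod (n := n) u (Finset.empty_subset _)

theorem sum_bernoulliWeight_mul_edgeInd (u : ℝ) {e : Sym2 (Fin n)} (he : e ∈ vertexPairs n) :
    ∑ G, bernoulliWeight u G * edgeInd e G = u := by
  simpa using sum_bernoulliWeight_mul_prod u (Finset.singleton_subset_iff.2 he)

theorem abs_sum_bernoulliWeight_triangle_sub_le {u : ℝ} (hu : u ∈ Set.Ioo (0 : ℝ) 1)
    (i j k : Fin n) :
    |∑ G, bernoulliWeight u G * (edgeInd s(i, j) G * edgeInd s(j, k) G * edgeInd s(i, k) G) -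
      u ^ 3| ≤ (if i = j then 1 else 0) + (if j = k then 1 else 0) + (if i = k then 1 else 0) := by
  have hu3 : |u ^ 3| ≤ 1 := by
    rw [abs_of_nonneg (pow_nonneg hu.1.le 3)]
    exact pow_le_one₀ hu.1.le hu.2.le
  by_cases hij : i = j
  · subst hij
    simp only [edgeInd_diag, zero_mul, mul_zero, Finset.sum_const_zero, zero_sub, abs_neg, if_true]
    split_ifs <;> linarith
  by_cases hjk : j = k
  · subst hjk
    simp only [edgeInd_diag, zero_mul, mul_zero, Finset.sum_const_zero, zero_sub, abs_neg, if_true]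
    split_ifs
    linarith
  by_cases hik : i = k
  · subst hik
    simp only [edgeInd_diag, mul_zero, Finset.sum_const_zero, zero_sub, abs_neg, if_true]
    split_ifs
    linarith
  have h := sum_bernoulliWeight_mul_prod u (A := {s(i, j), s(j, k), s(i, k)}) (by
    intro e he
    simp only [Finset.mem_insert, Finset.mem_singleton] at he
    rcases he with rfl | rfl | rfl <;> simpa [vertexPairs])
  have h1 : s(i, j) ∉ ({s(j, k), s(i, k)} : Finset (Sym2 (Fin n))) := by
    simp only [Finset.mem_insert, Finset.mem_singleton, Sym2.eq_iff]; grind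
  have h2 : s(j, k) ∉ ({s(i, k)} : Finset (Sym2 (Fin n))) := by
    simp only [Finset.mem_singleton, Sym2.eq_iff]; grind
  simp only [Finset.prod_insert h1, Finset.prod_insert h2, Finset.prod_singleton,
    Finset.card_insert_of_notMem h1, Finset.card_insert_of_notMem h2, Finset.card_singleton,
    ← mul_assoc] at h
  simp only [← mul_assoc, h]
  simp [hij, hjk, hik]

theorem two_mul_card_vertexPairs : 2 * ((vertexPairs n).card : ℝ) = (n : ℝ) ^ 2 - n := by
  have := sum_sum_sym2 (n := n) fun _ => (1 : ℝ)
  simp only [Finset.sum_const, Finset.card_univ, Fintype.card_fin, nsmul_eq_mul, mul_one] at this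
  linarith

theorem le_log_partition (α h : ℝ) {u : ℝ} (hu : u ∈ Set.Ioo (0 : ℝ) 1) (hn : 0 < n) :
    (n : ℝ) ^ 2 * (α / 6 * u ^ 3 + h / 2 * u + Real.binEntropy u / 2) -
        (|α| + |h| + 1) * n ≤
      Real.log (∑ G : SimpleGraph (Fin n), gibbsWeight α h G) := by
  have hn' : (0 : ℝ) < n := by exact_mod_cast hn
  have hu' : 0 < 1 - u := by linarith [hu.2]
  set Z := ∑ G : SimpleGraph (Fin n), gibbsWeight α h G with hZ
  have hZpos : 0 < Z := sum_gibbsWeight_pos α h n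
  have hfac : ∀ (G : SimpleGraph (Fin n)) (e : Sym2 (Fin n)),
      0 < if e ∈ G.edgeSet then u else 1 - u := by
    intro G e
    split_ifs
    · exact hu.1
    · exact hu'
  have hb : ∀ G : SimpleGraph (Fin n), 0 < bernoulliWeight u G := fun G =>
    Finset.prod_pos fun e _ => hfac G e
  have hG := sum_mul_log_le_sum_mul_log hb (sum_bernoulliWeight u)
    (q := fun G => gibbsWeight α h G / Z) (fun G => div_pos (gibbsWeight_pos α h G) hZpos)
    (by rw [← Finset.sum_div, ← hZ, div_self hZpos.ne'])
  have hlogq : ∀ G : SimpleGraph (Fin n), Real.log (gibbsWeight α h G / Z) =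
      Real.log (gibbsWeight α h G) - Real.log Z := fun G =>
    Real.log_div (gibbsWeight_pos α h G).ne' hZpos.ne'
  have hlogb : ∀ G : SimpleGraph (Fin n), Real.log (bernoulliWeight u G) =
      ∑ e ∈ vertexPairs n,
        (edgeInd e G * (Real.log u - Real.log (1 - u)) + Real.log (1 - u)) := by
    intro G
    rw [bernoulliWeight, Real.log_prod fun e _ => (hfac G e).ne']
    refine Finset.sum_congr rfl fun e _ => ?_
    simp only [edgeInd]
    split_ifs <;> ring
  have hent : ∑ G : SimpleGraph (Fin n), bernoulliWeight u G * Real.log (bernoulliWeight u G) =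
      -((vertexPairs n).card * Real.binEntropy u) := by
    simp only [hlogb, Finset.mul_sum, mul_add]
    rw [Finset.sum_comm]
    have : ∀ e ∈ vertexPairs n, ∑ G, (bernoulliWeight u G *
        (edgeInd e G * (Real.log u - Real.log (1 - u))) +
          bernoulliWeight u G * Real.log (1 - u)) = -Real.binEntropy u := by
      intro e he
      simp only [Finset.sum_add_distrib, ← mul_assoc, ← Finset.sum_mul,
        sum_bernoulliWeight_mul_edgeInd u he, sum_bernoulliWeight]
      rw [Real.binEntropy, Real.log_inv, Real.log_inv]
      ring
    rw [Finset.sum_congr rfl this]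
    simp
  have hedge : ∑ G, bernoulliWeight u G * (h * ∑ e ∈ vertexPairs n, edgeInd e G) =
      h * ((vertexPairs n).card * u) := by
    have : ∀ G, bernoulliWeight u G * (h * ∑ e ∈ vertexPairs n, edgeInd e G) =
        h * ∑ e ∈ vertexPairs n, bernoulliWeight u G * edgeInd e G := by
      intro G
      rw [← Finset.mul_sum]
      ring
    rw [Finset.sum_congr rfl fun G _ => this G, ← Finset.mul_sum, Finset.sum_comm,
      Finset.sum_congr rfl fun e he => sum_bernoulliWeight_mul_edgeInd u he]
    simp
  set t := ∑ G, bernoulliWeight u G *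
    (∑ i, ∑ j, ∑ k, edgeInd s(i, j) G * edgeInd s(j, k) G * edgeInd s(i, k) G) with ht
  have htri : |t - (n : ℝ) ^ 3 * u ^ 3| ≤ 3 * (n : ℝ) ^ 2 := by
    have h1 : t - (n : ℝ) ^ 3 * u ^ 3 = ∑ i : Fin n, ∑ j : Fin n, ∑ k : Fin n,
        (∑ G, bernoulliWeight u G * (edgeInd s(i, j) G * edgeInd s(j, k) G * edgeInd s(i, k) G) -
          u ^ 3) := by
      simp only [Finset.sum_sub_distrib]
      congr 1
      · simp only [ht, Finset.mul_sum]
        rw [Finset.sum_comm]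
        refine Finset.sum_congr rfl fun i _ => ?_
        rw [Finset.sum_comm]
        refine Finset.sum_congr rfl fun j _ => ?_
        rw [Finset.sum_comm]
      · simp
        ring
    rw [h1]
    calc _ ≤ ∑ i : Fin n, ∑ j : Fin n, ∑ k : Fin n,
        (((if i = j then 1 else 0) + (if j = k then 1 else 0) + (if i = k then 1 else 0)) : ℝ) := by
          refine (Finset.abs_sum_le_sum_abs _ _).trans (Finset.sum_le_sum fun i _ => ?_)
          refine (Finset.abs_sum_le_sum_abs _ _).trans (Finset.sum_le_sum fun j _ => ?_)
          refine (Finset.abs_sum_le_sum_abs _ _).trans (Finset.sum_le_sum fun k _ => ?_)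
          exact abs_sum_bernoulliWeight_triangle_sub_le hu i j k
      _ = 3 * (n : ℝ) ^ 2 := by
          simp [Finset.sum_add_distrib]
          ring
  have htri' : α / (6 * n) * t ≥ α / 6 * u ^ 3 * (n : ℝ) ^ 2 - |α| * n := by
    have h1 : α / (6 * n) * t - α / 6 * u ^ 3 * (n : ℝ) ^ 2 =
        α / (6 * n) * (t - (n : ℝ) ^ 3 * u ^ 3) := by
      field_simp
    have h2 : |α / (6 * n) * (t - (n : ℝ) ^ 3 * u ^ 3)| ≤ |α| * n := by
      rw [abs_mul, abs_div, abs_of_pos (by positivity : (0 : ℝ) < 6 * n)]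
      calc _ ≤ |α| / (6 * n) * (3 * (n : ℝ) ^ 2) := by gcongr
        _ = (|α| * n) / 2 := by field_simp; ring
        _ ≤ _ := by
          have : 0 ≤ |α| * n := by positivity
          linarith
    have := neg_abs_le (α / (6 * n) * (t - (n : ℝ) ^ 3 * u ^ 3))
    linarith
  have hpull : ∑ G : SimpleGraph (Fin n), bernoulliWeight u G * (α / (6 * n) *
      (∑ i, ∑ j, ∑ k, edgeInd s(i, j) G * edgeInd s(j, k) G * edgeInd s(i, k) G)) =
      α / (6 * n) * t := by
    rw [ht, Finset.mul_sum]
    exact Finset.sum_congr rfl fun G _ => by ring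
  simp only [hlogq, mul_sub, Finset.sum_sub_distrib, ← Finset.sum_mul, sum_bernoulliWeight,
    one_mul, log_gibbsWeight, mul_add, Finset.sum_add_distrib, hpull, hedge, hent] at hG
  have hcard := two_mul_card_vertexPairs (n := n)
  have hE : Real.binEntropy u ≤ 1 :=
    Real.binEntropy_le_log_two.trans (by linarith [Real.log_two_lt_d9])
  have hE0 : 0 ≤ Real.binEntropy u := Real.binEntropy_nonneg hu.1.le hu.2.le
  have hhu : h * u ≤ |h| := by
    calc h * u ≤ |h| * u := by gcongr; exacts [hu.1.le, le_abs_self h]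
      _ ≤ |h| := mul_le_of_le_one_right (abs_nonneg h) hu.2.le
  have hc : ((vertexPairs n).card : ℝ) = ((n : ℝ) ^ 2 - n) / 2 := by linarith
  rw [hc] at hG
  have h3 : n * (h * u) ≤ n * |h| := by gcongr
  have h4 : n * Real.binEntropy u ≤ n * 1 := by gcongr
  have h5 : 0 ≤ n * |h| := by positivity
  nlinarith

end Partition

section MeanFieldVariational

theorem gFun_eq (α h u : ℝ) :
    gFun α h u = α / 6 * u ^ 3 + h / 2 * u + Real.binEntropy u / 2 := by
  rw [gFun, Real.binEntropy, Real.log_inv, Real.log_inv]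
  ring

theorem continuous_gFun (α h : ℝ) : Continuous (gFun α h) := by
  rw [funext (gFun_eq α h)]
  fun_prop

theorem gFun_add (α h θ u : ℝ) : gFun (α + 6 * θ) h u = gFun α h u + θ * u ^ 3 := by
  simp only [gFun_eq]
  ring

theorem hasDerivAt_gFun (α h : ℝ) {u : ℝ} (hu : u ∈ Set.Ioo (0 : ℝ) 1) :
    HasDerivAt (gFun α h)
      (α / 2 * u ^ 2 + h / 2 + (Real.log (1 - u) - Real.log u) / 2) u := by
  rw [funext (gFun_eq α h)]
  have h1 := (((hasDerivAt_pow 3 u).const_mul (α / 6)).add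
    ((hasDerivAt_id u).const_mul (h / 2))).add
    ((Real.hasDerivAt_binEntropy hu.1.ne' hu.2.ne).div_const 2)
  refine h1.congr_deriv ?_
  push_cast
  ring

/-- Tangent-type lower bound for the triangle monomial around the constant profile `v`. -/
theorem triangle_lower_bound {v p q r : ℝ} (hv : v ∈ Set.Icc (0 : ℝ) 1)
    (hp : p ∈ Set.Icc (0 : ℝ) 1) (hq : q ∈ Set.Icc (0 : ℝ) 1) (hr : r ∈ Set.Icc (0 : ℝ) 1) :
    (v ^ 3 / 3 + v ^ 2 * (p - v) - (p - v) ^ 2) + (v ^ 3 / 3 + v ^ 2 * (q - v) - (q - v) ^ 2) +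
      (v ^ 3 / 3 + v ^ 2 * (r - v) - (r - v) ^ 2) ≤ p * q * r := by
  have key : ∀ a b c : ℝ, c ∈ Set.Icc (0 : ℝ) 1 →
      -((a ^ 2 + b ^ 2) / 2) ≤ (2 * v + c) / 3 * (a * b) := by
    intro a b c hc
    have h0 : 0 ≤ (2 * v + c) / 3 := by linarith [hv.1, hc.1]
    have h1 : 0 ≤ 1 - (2 * v + c) / 3 := by linarith [hv.2, hc.2]
    have h2 := mul_nonneg h0 (sq_nonneg (a + b))
    have h3 := mul_nonneg h1 (add_nonneg (sq_nonneg a) (sq_nonneg b))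
    nlinarith
  have h1 := key (p - v) (q - v) r hr
  have h2 := key (q - v) (r - v) p hp
  have h3 := key (p - v) (r - v) q hq
  have h4 : p * q * r = v ^ 3 + v ^ 2 * ((p - v) + (q - v) + (r - v)) +
      ((2 * v + r) / 3 * ((p - v) * (q - v)) + (2 * v + p) / 3 * ((q - v) * (r - v)) +
        (2 * v + q) / 3 * ((p - v) * (r - v))) := by ring
  linarith

/-- The entropy is at least as concave as `-2 u²`, so the quadratic majorant keeps the maximum at
a critical point. -/
theorem quadratic_majorant_le {α h v : ℝ} (hα : -2 < α) (hv : v ∈ Set.Ioo (0 : ℝ) 1)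
    (hcrit : α * v ^ 2 + h + (Real.log (1 - v) - Real.log v) = 0)
    {p : ℝ} (hp : p ∈ Set.Icc (0 : ℝ) 1) :
    α * (v ^ 3 / 3 + v ^ 2 * (p - v) - (p - v) ^ 2) + h * p + Real.binEntropy p ≤
      2 * gFun α h v := by
  let F : ℝ → ℝ := fun x =>
    -(α * (v ^ 3 / 3 + v ^ 2 * (x - v) - (x - v) ^ 2) + h * x + Real.binEntropy x)
  have hF' : ∀ x ∈ Set.Ioo (0 : ℝ) 1, HasDerivAt F
      (-(α * (v ^ 2 - 2 * (x - v)) + h + (Real.log (1 - x) - Real.log x))) x := by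
    intro x hx
    have h0 : HasDerivAt (fun x : ℝ => x - v) 1 x := (hasDerivAt_id x).sub_const v
    have h1 := ((((((h0.const_mul (v ^ 2)).const_add (v ^ 3 / 3)).sub (h0.pow 2)).const_mul α).add
      ((hasDerivAt_id x).const_mul h)).add (Real.hasDerivAt_binEntropy hx.1.ne' hx.2.ne)).neg
    refine h1.congr_deriv ?_
    push_cast
    ring
  have hF'' : ∀ x ∈ Set.Ioo (0 : ℝ) 1, HasDerivAt
      (fun x => -(α * (v ^ 2 - 2 * (x - v)) + h + (Real.log (1 - x) - Real.log x)))
      (2 * α + (1 / (1 - x) + 1 / x)) x := by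
    intro x hx
    have h0 : HasDerivAt (fun x : ℝ => x - v) 1 x := (hasDerivAt_id x).sub_const v
    have h2 : HasDerivAt (fun x : ℝ => 1 - x) (-1) x := (hasDerivAt_id x).const_sub 1
    have h1 := ((((((h0.const_mul 2).const_sub (v ^ 2)).const_mul α).add_const h).add
      ((h2.log (by linarith [hx.2])).sub (Real.hasDerivAt_log hx.1.ne'))).neg)
    refine h1.congr_deriv ?_
    rw [neg_div, one_div, one_div]
    ring
  have hconv : ConvexOn ℝ (Set.Icc (0 : ℝ) 1) F := by
    refine convexOn_of_hasDerivWithinAt2_nonneg (convex_Icc 0 1)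
      (f' := fun x => -(α * (v ^ 2 - 2 * (x - v)) + h + (Real.log (1 - x) - Real.log x)))
      (f'' := fun x => 2 * α + (1 / (1 - x) + 1 / x)) ?_ ?_ ?_ ?_
    · simp only [F]
      fun_prop
    · rw [interior_Icc]
      exact fun x hx => (hF' x hx).hasDerivWithinAt
    · rw [interior_Icc]
      exact fun x hx => (hF'' x hx).hasDerivWithinAt
    · rw [interior_Icc]
      intro x hx
      have hx1 : 0 < 1 - x := by linarith [hx.2]
      have hx0 := hx.1
      have : 4 ≤ 1 / (1 - x) + 1 / x := by
        rw [div_add_div _ _ hx1.ne' hx0.ne', le_div_iff₀ (by positivity)]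
        nlinarith [sq_nonneg (2 * x - 1)]
      linarith
  have hmin := hconv.isMinOn_of_rightDeriv_eq_zero (x := v) (by rwa [interior_Icc]) (by
    rw [(hF' v hv).hasDerivWithinAt.derivWithin (uniqueDiffWithinAt_Ioi v)]
    linarith)
  have h1 := hmin hp
  simp only [F, Set.mem_ofPred_eq] at h1
  rw [gFun_eq]
  linarith

theorem exists_triangle_majorant {α h v : ℝ} (hα : -2 < α) (hv : v ∈ Set.Ioo (0 : ℝ) 1)
    (hmax : ∀ u ∈ Set.Icc (0 : ℝ) 1, gFun α h u ≤ gFun α h v) :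
    ∃ ψ : ℝ → ℝ,
      (∀ p ∈ Set.Icc (0 : ℝ) 1, ∀ q ∈ Set.Icc (0 : ℝ) 1, ∀ r ∈ Set.Icc (0 : ℝ) 1,
        α * (p * q * r) ≤ ψ p + ψ q + ψ r) ∧
      ∀ p ∈ Set.Icc (0 : ℝ) 1, ψ p + h * p + Real.binEntropy p ≤ 2 * gFun α h v := by
  rcases le_or_gt 0 α with h0 | h0
  · refine ⟨fun p => α * (p ^ 3 / 3), fun p hp q hq r hr => ?_, fun p hp => ?_⟩
    · rw [← mul_add, ← mul_add]
      refine mul_le_mul_of_nonneg_left ?_ h0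
      have : 0 ≤ (p + q + r) * ((p - q) ^ 2 + (q - r) ^ 2 + (p - r) ^ 2) :=
        mul_nonneg (by linarith [hp.1, hq.1, hr.1]) (by positivity)
      nlinarith
    · have := hmax p hp
      rw [gFun_eq α h p] at this
      linarith
  · have hloc : IsLocalMax (gFun α h) v :=
      Filter.mem_of_superset (Icc_mem_nhds hv.1 hv.2) hmax
    have hcrit := hloc.hasDerivAt_eq_zero (hasDerivAt_gFun α h hv)
    refine ⟨fun p => α * (v ^ 3 / 3 + v ^ 2 * (p - v) - (p - v) ^ 2),
      fun p hp q hq r hr => ?_, fun p hp => ?_⟩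
    · rw [← mul_add, ← mul_add]
      exact mul_le_mul_of_nonpos_left
        (triangle_lower_bound (Set.Ioo_subset_Icc_self hv) hp hq hr) h0.le
    · exact quadratic_majorant_le hα hv (by linarith) hp

/-- The maximum of `gFun` is differentiable in the triangle parameter at a unique maximizer. -/
theorem exists_perturbed_maximizer {α h u₀ : ℝ} (hα : -2 < α) (hu₀ : u₀ ∈ Set.Ioo (0 : ℝ) 1)
    (hmax : ∀ u ∈ Set.Icc (0 : ℝ) 1, gFun α h u ≤ gFun α h u₀)
    (huniq : ∀ u ∈ Set.Icc (0 : ℝ) 1, gFun α h u = gFun α h u₀ → u = u₀)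
    {κ : ℝ} (hκ : 0 < κ) :
    ∃ θ₀ > 0, ∀ θ : ℝ, |θ| ≤ θ₀ → -2 < α + 6 * θ ∧ ∃ v ∈ Set.Ioo (0 : ℝ) 1,
      (∀ u ∈ Set.Icc (0 : ℝ) 1, gFun (α + 6 * θ) h u ≤ gFun (α + 6 * θ) h v) ∧
      gFun (α + 6 * θ) h v ≤ gFun α h u₀ + θ * u₀ ^ 3 + |θ| * κ := by
  have hu₀3 : 0 < u₀ ^ 3 := pow_pos hu₀.1 3
  have hu₀3' : u₀ ^ 3 < 1 := pow_lt_one₀ hu₀.1.le hu₀.2 (by norm_num)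
  obtain ⟨κ', hκ', hκ'1, hκ'2, hκ'3⟩ :
      ∃ κ' > 0, κ' ≤ κ ∧ κ' ≤ u₀ ^ 3 ∧ κ' ≤ 1 - u₀ ^ 3 :=
    ⟨min κ (min (u₀ ^ 3) (1 - u₀ ^ 3)), by simp [hκ, hu₀3, hu₀3'],
      min_le_left _ _, (min_le_right _ _).trans (min_le_left _ _),
      (min_le_right _ _).trans (min_le_right _ _)⟩
  let K : Set ℝ := Set.Icc (0 : ℝ) 1 ∩ {u | κ' ≤ |u ^ 3 - u₀ ^ 3|}
  have hK : IsCompact K := isCompact_Icc.inter_right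
    (isClosed_le continuous_const (by fun_prop))
  obtain ⟨η, hη, hgap⟩ : ∃ η > 0, ∀ u ∈ K, gFun α h u ≤ gFun α h u₀ - η := by
    have h0 : (0 : ℝ) ∈ K := by
      refine ⟨by simp, ?_⟩
      simp only [Set.mem_ofPred_eq]
      rw [zero_pow (by norm_num), zero_sub, abs_neg, abs_of_pos hu₀3]
      exact hκ'2
    obtain ⟨z, hz, hzmax⟩ := hK.exists_isMaxOn ⟨0, h0⟩ (continuous_gFun α h).continuousOn
    have hlt : gFun α h z < gFun α h u₀ := by
      refine lt_of_le_of_ne (hmax z hz.1) fun heq => ?_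
      have := hz.2
      rw [huniq z hz.1 heq] at this
      simp only [Set.mem_ofPred_eq, sub_self, abs_zero] at this
      linarith
    exact ⟨gFun α h u₀ - gFun α h z, by linarith, fun u hu => by
      have : gFun α h u ≤ gFun α h z := hzmax hu
      linarith⟩
  refine ⟨min ((α + 2) / 12) (η / 4), by
    rw [gt_iff_lt, lt_min_iff]; constructor <;> linarith, fun θ hθ => ?_⟩
  have hθ1 := hθ.trans (min_le_left _ _)
  have hθ2 := hθ.trans (min_le_right _ _)
  have hθle := le_abs_self θ
  have hθge := neg_abs_le θ
  refine ⟨by linarith, ?_⟩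
  obtain ⟨v, hv, hvmax⟩ := isCompact_Icc.exists_isMaxOn (Set.nonempty_Icc.2 zero_le_one)
    (continuous_gFun (α + 6 * θ) h).continuousOn
  have hvu₀ : gFun (α + 6 * θ) h u₀ ≤ gFun (α + 6 * θ) h v := hvmax ⟨hu₀.1.le, hu₀.2.le⟩
  rw [gFun_add, gFun_add] at hvu₀
  have hdiff : |θ * (v ^ 3 - u₀ ^ 3)| ≤ |θ| := by
    rw [abs_mul]
    refine mul_le_of_le_one_right (abs_nonneg θ) ?_
    have := pow_nonneg hv.1 3
    have := pow_le_one₀ hv.1 hv.2 (n := 3)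
    rw [abs_le]
    constructor <;> linarith
  have hclose : |v ^ 3 - u₀ ^ 3| < κ' := by
    by_contra! hfar
    have h1 := hgap v ⟨hv, hfar⟩
    have h2 := le_abs_self (θ * (v ^ 3 - u₀ ^ 3))
    linarith
  have hc := abs_lt.1 hclose
  refine ⟨v, ⟨?_, ?_⟩, fun u hu => hvmax hu, ?_⟩
  · refine lt_of_le_of_ne hv.1 fun h0 => ?_
    rw [← h0] at hc
    norm_num at hc
    linarith
  · refine lt_of_le_of_ne hv.2 fun h1 => ?_
    rw [h1] at hc
    norm_num at hc
    linarith
  · have h1 := hmax v hv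
    have h2 : θ * (v ^ 3 - u₀ ^ 3) ≤ |θ| * κ := by
      refine (le_abs_self _).trans ?_
      rw [abs_mul]
      exact mul_le_mul_of_nonneg_left (hclose.le.trans hκ'1) (abs_nonneg θ)
    rw [gFun_add]
    linarith

end MeanFieldVariational

section Concentration

/-- Tilting the triangle parameter bounds the weight of an atypical triangle density. -/
theorem gibbsWeight_le_tilt {n : ℕ} (hn : 0 < n) (α h c ε : ℝ) {θ : ℝ} (hθ : 0 ≤ θ)
    (G : SimpleGraph (Fin n)) (hG : ε ≤ |6 * (triCount G : ℝ) / (n : ℝ) ^ 3 - c|) :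
    gibbsWeight α h G ≤
      gibbsWeight (α + 6 * θ) h G * Real.exp (-(θ * (c + ε) * (n : ℝ) ^ 2)) +
        gibbsWeight (α + 6 * -θ) h G * Real.exp (θ * (c - ε) * (n : ℝ) ^ 2) := by
  have hn' : (0 : ℝ) < n := by exact_mod_cast hn
  set t := 6 * (triCount G : ℝ) / (n : ℝ) ^ 3 with ht
  have htri : ∀ s : ℝ, (α + 6 * s) / n * triCount G =
      α / n * triCount G + s * t * (n : ℝ) ^ 2 := by
    intro s
    rw [ht]
    field_simp
  simp only [gibbsWeight, htri, ← Real.exp_add]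
  rcases le_abs'.1 hG with h1 | h1
  · refine le_add_of_nonneg_of_le (Real.exp_pos _).le (Real.exp_le_exp.2 ?_)
    have h2 : 0 ≤ θ * (c - ε - t) * (n : ℝ) ^ 2 :=
      mul_nonneg (mul_nonneg hθ (by linarith)) (by positivity)
    linarith
  · refine le_add_of_le_of_nonneg (Real.exp_le_exp.2 ?_) (Real.exp_pos _).le
    have h2 : 0 ≤ θ * (t - (c + ε)) * (n : ℝ) ^ 2 :=
      mul_nonneg (mul_nonneg hθ (by linarith)) (by positivity)
    linarith

/-- Ratio of partition functions at nearby triangle parameters. -/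
theorem exists_partition_ratio_le {α h u₀ M κ s : ℝ} (hu₀ : u₀ ∈ Set.Ioo (0 : ℝ) 1)
    (hs : -2 < s) {v : ℝ} (hv : v ∈ Set.Ioo (0 : ℝ) 1)
    (hmax : ∀ u ∈ Set.Icc (0 : ℝ) 1, gFun s h u ≤ gFun s h v)
    (hM : gFun s h v ≤ gFun α h u₀ + M) (hκ : 0 < κ) :
    ∃ C : ℝ, ∀ n : ℕ, 0 < n →
      (∑ G : SimpleGraph (Fin n), gibbsWeight s h G) /
        (∑ G : SimpleGraph (Fin n), gibbsWeight α h G) ≤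
      Real.exp ((n : ℝ) ^ 2 * (M + κ) + C * n) := by
  obtain ⟨ψ, hψ, hψM⟩ := exists_triangle_majorant hs hv hmax
  obtain ⟨η, hη, hηκ⟩ : ∃ η > 0, |s| * η ≤ κ := by
    refine ⟨κ / (|s| + 1), by positivity, ?_⟩
    rw [mul_div_assoc', div_le_iff₀ (by positivity)]
    nlinarith [abs_nonneg s]
  obtain ⟨K, hK⟩ := exists_nat_gt (1 / η ^ 2)
  rw [div_lt_iff₀ (by positivity)] at hK
  refine ⟨K + (|α| + |h| + 1), fun n hn => ?_⟩
  have h1 := log_partition_le hψ hψM hη hK hn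
  have h2 := le_log_partition α h hu₀ hn
  rw [← gFun_eq] at h2
  have hs0 := sum_gibbsWeight_pos s h n
  have hα0 := sum_gibbsWeight_pos α h n
  rw [← Real.exp_log (div_pos hs0 hα0), Real.exp_le_exp, Real.log_div hs0.ne' hα0.ne']
  have h3 : (n : ℝ) ^ 2 * (gFun s h v + |s| * η) ≤ (n : ℝ) ^ 2 * (gFun α h u₀ + M + κ) := by
    gcongr
  linarith

end Concentration

/-- Exponential concentration underlying the SLLN for the triangle density. -/
theorem edge_triangle_exponential_concentration_unique_maximizer
    (α h : ℝ) (hα : α > -2) (u₀ : ℝ) (hu₀ : u₀ ∈ Set.Ioo (0 : ℝ) 1)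
    (hmax : ∀ u ∈ Set.Icc (0 : ℝ) 1, gFun α h u ≤ gFun α h u₀)
    (huniq : ∀ u ∈ Set.Icc (0 : ℝ) 1, gFun α h u = gFun α h u₀ → u = u₀) :
    ∀ ε > 0, ∃ τ > 0, ∃ N : ℕ, ∀ n ≥ N,
      gibbsProb α h n
          {G : SimpleGraph (Fin n) | ε ≤ |6 * (triCount G : ℝ) / (n : ℝ) ^ 3 - u₀ ^ 3|} ≤
        Real.exp (-τ * (n : ℝ) ^ 2) := by
  intro ε hε
  obtain ⟨θ, hθ, hpert⟩ :=
    exists_perturbed_maximizer hα hu₀ hmax huniq (κ := ε / 4) (by positivity)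
  obtain ⟨hs₁, v₁, hv₁, hmax₁, hM₁⟩ := hpert θ (abs_of_pos hθ).le
  obtain ⟨hs₂, v₂, hv₂, hmax₂, hM₂⟩ := hpert (-θ) (by rw [abs_neg, abs_of_pos hθ])
  rw [abs_of_pos hθ] at hM₁
  rw [abs_neg, abs_of_pos hθ] at hM₂
  have hκ : 0 < θ * ε / 4 := by positivity
  obtain ⟨C₁, hC₁⟩ := exists_partition_ratio_le (α := α)
    (M := θ * u₀ ^ 3 + θ * (ε / 4)) hu₀ hs₁ hv₁ hmax₁
    (by linarith) hκ
  obtain ⟨C₂, hC₂⟩ := exists_partition_ratio_le (α := α)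
    (M := -θ * u₀ ^ 3 + θ * (ε / 4)) hu₀ hs₂ hv₂ hmax₂
    (by linarith) hκ
  obtain ⟨N, hN⟩ := exists_nat_gt ((max C₁ C₂ + 1) / (θ * ε / 4))
  rw [div_lt_iff₀ hκ] at hN
  refine ⟨θ * ε / 4, hκ, max N 1, fun n hn => ?_⟩
  have hn1 : 1 ≤ n := (le_max_right _ _).trans hn
  have hnN : (N : ℝ) ≤ n := by exact_mod_cast (le_max_left _ _).trans hn
  have hn1' : (1 : ℝ) ≤ n := by exact_mod_cast hn1
  have hZ := sum_gibbsWeight_pos α h n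
  set b := Real.exp (-(θ * (u₀ ^ 3 + ε) * (n : ℝ) ^ 2))
  set c := Real.exp (θ * (u₀ ^ 3 - ε) * (n : ℝ) ^ 2)
  have hprob : gibbsProb α h n
      {G : SimpleGraph (Fin n) | ε ≤ |6 * (triCount G : ℝ) / (n : ℝ) ^ 3 - u₀ ^ 3|} ≤
      (∑ G : SimpleGraph (Fin n), gibbsWeight (α + 6 * θ) h G) /
        (∑ G : SimpleGraph (Fin n), gibbsWeight α h G) * b +
      (∑ G : SimpleGraph (Fin n), gibbsWeight (α + 6 * -θ) h G) /
        (∑ G : SimpleGraph (Fin n), gibbsWeight α h G) * c := by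
    rw [gibbsProb, div_mul_eq_mul_div, div_mul_eq_mul_div, ← add_div, Finset.sum_mul,
      Finset.sum_mul, ← Finset.sum_add_distrib]
    refine div_le_div_of_nonneg_right (Finset.sum_le_sum fun G _ => ?_) hZ.le
    split_ifs with hG
    · exact gibbsWeight_le_tilt hn1 α h (u₀ ^ 3) ε hθ.le G hG
    · exact add_nonneg (mul_nonneg (gibbsWeight_pos _ h G).le (Real.exp_pos _).le)
        (mul_nonneg (gibbsWeight_pos _ h G).le (Real.exp_pos _).le)
  have hlin : ∀ C ≤ max C₁ C₂, -(θ * ε / 2) * (n : ℝ) ^ 2 + C * n ≤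
      -(θ * ε / 4) * (n : ℝ) ^ 2 - 1 := by
    intro C hC
    have h1 : C + 1 ≤ n * (θ * ε / 4) := by nlinarith
    nlinarith
  have h₁ : (∑ G : SimpleGraph (Fin n), gibbsWeight (α + 6 * θ) h G) /
      (∑ G : SimpleGraph (Fin n), gibbsWeight α h G) * b ≤
      Real.exp (-(θ * ε / 4) * (n : ℝ) ^ 2 - 1) := by
    refine (mul_le_mul_of_nonneg_right (hC₁ n hn1) (Real.exp_pos _).le).trans ?_
    rw [← Real.exp_add, Real.exp_le_exp]
    linarith [hlin C₁ (le_max_left _ _)]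
  have h₂ : (∑ G : SimpleGraph (Fin n), gibbsWeight (α + 6 * -θ) h G) /
      (∑ G : SimpleGraph (Fin n), gibbsWeight α h G) * c ≤
      Real.exp (-(θ * ε / 4) * (n : ℝ) ^ 2 - 1) := by
    refine (mul_le_mul_of_nonneg_right (hC₂ n hn1) (Real.exp_pos _).le).trans ?_
    rw [← Real.exp_add, Real.exp_le_exp]
    linarith [hlin C₂ (le_max_right _ _)]
  have hexp : 2 * Real.exp (-(θ * ε / 4) * (n : ℝ) ^ 2 - 1) ≤
      Real.exp (-(θ * ε / 4) * (n : ℝ) ^ 2) := by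
    rw [Real.exp_sub, mul_div_assoc', div_le_iff₀ (Real.exp_pos _), mul_comm]
    refine mul_le_mul_of_nonneg_left ?_ (Real.exp_pos _).le
    linarith [Real.add_one_le_exp (1 : ℝ)]
  linarith
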